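/- Let M be a parallelizable orientable smooth 4-manifold and D an Engel structure on M. Then D admits Engel defining forms if and only if D is orientable as a plane bundle. -/

import Mathlib

noncomputable section

open Manifold Module Function Set

variable {E : Type*} [NormedAddCommGroup E] [NormedSpace ℝ E]
  {H : Type*} [TopologicalSpace H]

/-- The type of (not necessarily smooth) vector fields on a manifold. -/
abbrev VF (I : ModelWithCorners ℝ E H) (M : Type*) [TopologicalSpace M] [ChartedSpace H M] :=
  ∀ x : M, TangentSpace I x

/-- A vector field is smooth if the corresponding section of the tangent bundle is smooth. -/
def SmoothVF (I : ModelWithCorners ℝ E H) {M : Type*} [TopologicalSpace M] [ChartedSpace H M]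
    [IsManifold I (⊤ : ℕ∞) M] (V : VF I M) : Prop :=
  ContMDiff I I.tangent (⊤ : ℕ∞) (fun x => (⟨x, V x⟩ : TangentBundle I M))

/-- A smooth real valued function on a manifold. -/
def SmoothFn (I : ModelWithCorners ℝ E H) {M : Type*} [TopologicalSpace M] [ChartedSpace H M]
    [IsManifold I (⊤ : ℕ∞) M] (f : M → ℝ) : Prop :=
  ContMDiff I 𝓘(ℝ) (⊤ : ℕ∞) f

/-- Derivative of a real valued function along a vector field. -/
def vderiv (I : ModelWithCorners ℝ E H) {M : Type*} [TopologicalSpace M] [ChartedSpace H M]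
    [IsManifold I (⊤ : ℕ∞) M] (V : VF I M) (f : M → ℝ) : M → ℝ :=
  fun x => mfderiv I 𝓘(ℝ) f x (V x)

/-- The Lie bracket of two vector fields on a manifold, defined by transporting the two
vector fields to the model space via the preferred chart at the given point, taking the
Lie bracket of vector fields there, and transporting the result back.  For smooth vector
fields this is the usual Lie bracket `[V, W]`. -/
def vfLie (I : ModelWithCorners ℝ E H) {M : Type*} [TopologicalSpace M] [ChartedSpace H M]
    [IsManifold I (⊤ : ℕ∞) M] (V W : VF I M) : VF I M := fun x₀ =>
  mfderiv 𝓘(ℝ, E) I (extChartAt I x₀).symm (extChartAt I x₀ x₀)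
    ((VectorField.lieBracket ℝ
      (fun e => (mfderiv I 𝓘(ℝ, E) (extChartAt I x₀) ((extChartAt I x₀).symm e)
        (V ((extChartAt I x₀).symm e)) : E))
      (fun e => (mfderiv I 𝓘(ℝ, E) (extChartAt I x₀) ((extChartAt I x₀).symm e)
        (W ((extChartAt I x₀).symm e)) : E))
      (extChartAt I x₀ x₀) : E))

/-- A smooth differential `1`-form on a manifold, given by its pointwise values. -/
structure OneForm (I : ModelWithCorners ℝ E H) (M : Type*) [TopologicalSpace M]
    [ChartedSpace H M] [IsManifold I (⊤ : ℕ∞) M] where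
  val : ∀ x : M, TangentSpace I x →ₗ[ℝ] ℝ
  smooth' : ∀ V : VF I M, SmoothVF I V → SmoothFn I (fun x => val x (V x))

/-- A smooth differential `k`-form on a manifold, given by its pointwise values. -/
structure FormPt (I : ModelWithCorners ℝ E H) (M : Type*) [TopologicalSpace M]
    [ChartedSpace H M] [IsManifold I (⊤ : ℕ∞) M] (k : ℕ) where
  val : ∀ x : M, (TangentSpace I x) [⋀^Fin k]→ₗ[ℝ] ℝ
  smooth' : ∀ V : Fin k → VF I M, (∀ i, SmoothVF I (V i)) →
    SmoothFn I (fun x => val x (fun i => V i x))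

variable {I : ModelWithCorners ℝ E H} {M : Type*} [TopologicalSpace M] [ChartedSpace H M]
  [IsManifold I (⊤ : ℕ∞) M]

/-- The exterior derivative of a (pointwise defined) `1`-form, evaluated on two vector
fields, via the Cartan formula `dω(V,W) = V (ω W) - W (ω V) - ω [V,W]`.  Here the `1`-form
is given as a function on vector fields. -/
def dOfFun (I : ModelWithCorners ℝ E H) {M : Type*} [TopologicalSpace M] [ChartedSpace H M]
    [IsManifold I (⊤ : ℕ∞) M] (lam : VF I M → M → ℝ) (V W : VF I M) : M → ℝ :=
  fun x => vderiv I V (lam W) x - vderiv I W (lam V) x - lam (vfLie I V W) x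

/-- The exterior derivative of a `1`-form, as a function of two vector fields. -/
def OneForm.d (ω : OneForm I M) (V W : VF I M) : M → ℝ :=
  dOfFun I (fun U x => ω.val x (U x)) V W

/-- A distribution (field of tangent subspaces) on a manifold. -/
abbrev TangentDist (I : ModelWithCorners ℝ E H) (M : Type*) [TopologicalSpace M] [ChartedSpace H M] :=
  ∀ x : M, Submodule ℝ (TangentSpace I x)

/-- A (smooth) section of a distribution. -/
def IsSection (I : ModelWithCorners ℝ E H) {M : Type*} [TopologicalSpace M] [ChartedSpace H M]
    [IsManifold I (⊤ : ℕ∞) M] (D : TangentDist I M) (V : VF I M) : Prop :=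
  SmoothVF I V ∧ ∀ x, V x ∈ D x

/-- The distribution `[D, D]` generated by a distribution `D` together with all Lie brackets
of its sections. -/
def derivedDist (I : ModelWithCorners ℝ E H) {M : Type*} [TopologicalSpace M] [ChartedSpace H M]
    [IsManifold I (⊤ : ℕ∞) M] (D : TangentDist I M) : TangentDist I M := fun x =>
  Submodule.span ℝ
    ({v | ∃ V, IsSection I D V ∧ V x = v} ∪
     {v | ∃ V W, IsSection I D V ∧ IsSection I D W ∧ vfLie I V W x = v})

/-- A distribution is integrable (in the sense of Frobenius: involutive) if Lie brackets of
its sections are again tangent to it. -/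
def IsIntegrableDist (I : ModelWithCorners ℝ E H) {M : Type*} [TopologicalSpace M]
    [ChartedSpace H M] [IsManifold I (⊤ : ℕ∞) M] (D : TangentDist I M) : Prop :=
  ∀ V W, IsSection I D V → IsSection I D W → ∀ x, vfLie I V W x ∈ D x

/-- `(ω ∧ θ)(U,V,W)` for a `1`-form `ω` and a `2`-form `θ` given as a function of two
vector fields. -/
def wedge1_2 (I : ModelWithCorners ℝ E H) {M : Type*} [TopologicalSpace M] [ChartedSpace H M]
    [IsManifold I (⊤ : ℕ∞) M] (ω : OneForm I M) (θ : VF I M → VF I M → M → ℝ)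
    (U V W : VF I M) : M → ℝ := fun x =>
  ω.val x (U x) * θ V W x - ω.val x (V x) * θ U W x + ω.val x (W x) * θ U V x

/-- The square `θ ∧ θ` of a `2`-form `θ` (given as a function of two vector fields) vanishes
identically. -/
def FormSqZero (I : ModelWithCorners ℝ E H) {M : Type*} [TopologicalSpace M] [ChartedSpace H M]
    [IsManifold I (⊤ : ℕ∞) M] (θ : VF I M → VF I M → M → ℝ) : Prop :=
  ∀ V₀ V₁ V₂ V₃ : VF I M, SmoothVF I V₀ → SmoothVF I V₁ → SmoothVF I V₂ → SmoothVF I V₃ →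
    ∀ x, θ V₀ V₁ x * θ V₂ V₃ x - θ V₀ V₂ x * θ V₁ V₃ x + θ V₀ V₃ x * θ V₁ V₂ x = 0

/-- An Engel structure: a rank 2 distribution `D` such that `E := [D,D]` has rank 3 and
`[E,E] = TM`. -/
def IsEngel (I : ModelWithCorners ℝ E H) {M : Type*} [TopologicalSpace M] [ChartedSpace H M]
    [IsManifold I (⊤ : ℕ∞) M] (D : TangentDist I M) : Prop :=
  (∀ x, Module.finrank ℝ (D x) = 2) ∧ (∀ x, Module.finrank ℝ (derivedDist I D x) = 3) ∧
  (∀ x, derivedDist I (derivedDist I D) x = ⊤)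

/-- Engel defining forms: `D = ker α ∩ ker β` and `E = [D,D] = ker α`. -/
def EngelDefiningForms (I : ModelWithCorners ℝ E H) {M : Type*} [TopologicalSpace M]
    [ChartedSpace H M] [IsManifold I (⊤ : ℕ∞) M] (D : TangentDist I M)
    (α β : OneForm I M) : Prop :=
  (∀ x, D x = LinearMap.ker (α.val x) ⊓ LinearMap.ker (β.val x)) ∧
  (∀ x, derivedDist I D x = LinearMap.ker (α.val x))

/-- The pair of Reeb vector fields `T`, `R` associated with Engel defining forms `α`, `β`:
`i_T(α ∧ dβ) = 0`, `β(T) = 1`, `α(T) = 0`, `i_R(β ∧ dβ) = 0`, `β(R) = 0`, `α(R) = 1`. -/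
structure IsReebPair (I : ModelWithCorners ℝ E H) {M : Type*} [TopologicalSpace M]
    [ChartedSpace H M] [IsManifold I (⊤ : ℕ∞) M] (α β : OneForm I M)
    (T R : VF I M) : Prop where
  smoothT : SmoothVF I T
  smoothR : SmoothVF I R
  alphaT : ∀ x, α.val x (T x) = 0
  betaT : ∀ x, β.val x (T x) = 1
  alphaR : ∀ x, α.val x (R x) = 1
  betaR : ∀ x, β.val x (R x) = 0
  insT : ∀ V W, SmoothVF I V → SmoothVF I W → ∀ x, wedge1_2 I α β.d T V W x = 0
  insR : ∀ V W, SmoothVF I V → SmoothVF I W → ∀ x, wedge1_2 I β β.d R V W x = 0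

/-- The Reeb distribution spanned by the two Reeb vector fields. -/
def reebDist (I : ModelWithCorners ℝ E H) {M : Type*} [TopologicalSpace M] [ChartedSpace H M]
    (T R : VF I M) : TangentDist I M := fun x => Submodule.span ℝ {T x, R x}

/-- `W` is a nonsingular vector field spanning the characteristic foliation of the even
contact structure `E = [D,D]`:  `W` is tangent to `D` and `[W, E] ⊆ E`. -/
def SpansChar (I : ModelWithCorners ℝ E H) {M : Type*} [TopologicalSpace M] [ChartedSpace H M]
    [IsManifold I (⊤ : ℕ∞) M] (D : TangentDist I M) (W : VF I M) : Prop :=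
  SmoothVF I W ∧ (∀ x, W x ≠ 0) ∧ (∀ x, W x ∈ D x) ∧
  ∀ V, IsSection I (derivedDist I D) V → ∀ x, vfLie I W V x ∈ derivedDist I D x

/-- A Riemannian metric, given by its pointwise values. -/
structure RMetric (I : ModelWithCorners ℝ E H) (M : Type*) [TopologicalSpace M]
    [ChartedSpace H M] [IsManifold I (⊤ : ℕ∞) M] where
  val : ∀ x : M, TangentSpace I x →ₗ[ℝ] TangentSpace I x →ₗ[ℝ] ℝ
  symm : ∀ x u v, val x u v = val x v u
  posdef : ∀ x v, v ≠ 0 → 0 < val x v v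
  smooth' : ∀ V W, SmoothVF I V → SmoothVF I W → SmoothFn I (fun x => val x (V x) (W x))

/-- The Koszul formula: `koszul g X Y Z = g(∇_X Y, Z)` where `∇` is the Levi-Civita
connection of `g`. -/
def koszul (I : ModelWithCorners ℝ E H) {M : Type*} [TopologicalSpace M] [ChartedSpace H M]
    [IsManifold I (⊤ : ℕ∞) M] (g : RMetric I M) (X Y Z : VF I M) : M → ℝ := fun x =>
  (vderiv I X (fun y => g.val y (Y y) (Z y)) x + vderiv I Y (fun y => g.val y (X y) (Z y)) x
    - vderiv I Z (fun y => g.val y (X y) (Y y)) x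
    + g.val x (vfLie I X Y x) (Z x) - g.val x (vfLie I X Z x) (Y x)
    - g.val x (vfLie I Y Z x) (X x)) / 2

/-- A distribution `D` is totally geodesic for `g` iff every geodesic tangent to it at one
point stays tangent to it; equivalently (the standard characterization, which we take as the
definition) `∇_U U` is tangent to `D` for every section `U` of `D`, i.e. `g(∇_U U, V) = 0`
for every vector field `V` orthogonal to `D`. -/
def IsTotallyGeodesic (I : ModelWithCorners ℝ E H) {M : Type*} [TopologicalSpace M]
    [ChartedSpace H M] [IsManifold I (⊤ : ℕ∞) M] (g : RMetric I M)
    (D : TangentDist I M) : Prop :=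
  ∀ U, IsSection I D U → ∀ V, SmoothVF I V → (∀ x, ∀ u ∈ D x, g.val x (V x) u = 0) →
    ∀ x, koszul I g U U V x = 0

/-- A Killing vector field: `L_Z g = 0`, expressed on vector fields. -/
def IsKilling (I : ModelWithCorners ℝ E H) {M : Type*} [TopologicalSpace M] [ChartedSpace H M]
    [IsManifold I (⊤ : ℕ∞) M] (g : RMetric I M) (Z : VF I M) : Prop :=
  ∀ V W, SmoothVF I V → SmoothVF I W → ∀ x,
    vderiv I Z (fun y => g.val y (V y) (W y)) x
      = g.val x (vfLie I Z V x) (W x) + g.val x (V x) (vfLie I Z W x)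

/-- An Engel vector field: the flow of `Z` preserves `D`, i.e. `L_Z D ⊆ D`. -/
def IsEngelVF (I : ModelWithCorners ℝ E H) {M : Type*} [TopologicalSpace M] [ChartedSpace H M]
    [IsManifold I (⊤ : ℕ∞) M] (D : TangentDist I M) (Z : VF I M) : Prop :=
  SmoothVF I Z ∧ ∀ V, IsSection I D V → ∀ x, vfLie I Z V x ∈ D x

/-- A K-Engel structure: `D` is an Engel structure, `g` a Riemannian metric and `Z` a
(nowhere vanishing) vector field which is Engel, Killing and orthogonal to `E = [D,D]`. -/
structure IsKEngel (I : ModelWithCorners ℝ E H) {M : Type*} [TopologicalSpace M]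
    [ChartedSpace H M] [IsManifold I (⊤ : ℕ∞) M] (D : TangentDist I M)
    (g : RMetric I M) (Z : VF I M) : Prop where
  engel : IsEngel I D
  engelVF : IsEngelVF I D Z
  killing : IsKilling I g Z
  orth : ∀ x, ∀ v ∈ derivedDist I D x, g.val x (Z x) v = 0
  nonzero : ∀ x, Z x ≠ 0

/-- A `1`-form is closed. -/
def OneForm.IsClosed {I : ModelWithCorners ℝ E H} {M : Type*} [TopologicalSpace M]
    [ChartedSpace H M] [IsManifold I (⊤ : ℕ∞) M] (ω : OneForm I M) : Prop :=
  ∀ V W, SmoothVF I V → SmoothVF I W → ∀ x, ω.d V W x = 0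

/-- The Lie derivative `(L_Z ω)(V) = Z (ω V) - ω [Z,V]` of a `1`-form along a vector
field, as a function of vector fields. -/
def lieOneForm (I : ModelWithCorners ℝ E H) {M : Type*} [TopologicalSpace M] [ChartedSpace H M]
    [IsManifold I (⊤ : ℕ∞) M] (ω : OneForm I M) (Z V : VF I M) : M → ℝ := fun x =>
  vderiv I Z (fun y => ω.val y (V y)) x - ω.val x (vfLie I Z V x)

/-- The exterior derivative of a pointwise-defined `(m+1)`-form evaluated on `m+2` vector
fields, via the global Koszul formula. -/
def extDerEval (I : ModelWithCorners ℝ E H) {M : Type*} [TopologicalSpace M] [ChartedSpace H M]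
    [IsManifold I (⊤ : ℕ∞) M] {m : ℕ} (ν : FormPt I M (m+1)) (V : Fin (m+2) → VF I M) :
    M → ℝ := fun x =>
  (∑ i : Fin (m+2), (-1 : ℝ)^(i : ℕ) *
    vderiv I (V i) (fun y => ν.val y (fun l => V (i.succAbove l) y)) x)
  + ∑ i : Fin (m+2), ∑ j : Fin (m+2), if h : (i : ℕ) < (j : ℕ) then
      (-1 : ℝ)^((i : ℕ)+(j : ℕ)) * ν.val x (Fin.cons (vfLie I (V i) (V j) x)
        (fun l => V (j.succAbove ((⟨(i : ℕ), by have := j.2; omega⟩ : Fin (m+1)).succAbove l)) x))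
    else 0

/-- A pointwise-defined form is closed. -/
def FormPt.IsClosedForm {I : ModelWithCorners ℝ E H} {M : Type*} [TopologicalSpace M]
    [ChartedSpace H M] [IsManifold I (⊤ : ℕ∞) M] {m : ℕ} (ν : FormPt I M (m+1)) : Prop :=
  ∀ V : Fin (m+2) → VF I M, (∀ i, SmoothVF I (V i)) → ∀ x, extDerEval I ν V x = 0

/-- `φ : ℝ → M → M` is the flow of the vector field `Z`. -/
def IsFlowOf (I : ModelWithCorners ℝ E H) {M : Type*} [TopologicalSpace M] [ChartedSpace H M]
    [IsManifold I (⊤ : ℕ∞) M] (Z : VF I M) (φ : ℝ → M → M) : Prop :=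
  Continuous (fun p : ℝ × M => φ p.1 p.2) ∧ (∀ x, φ 0 x = x) ∧
  (∀ s t x, φ (s + t) x = φ s (φ t x)) ∧
  ∀ x t, HasMFDerivAt 𝓘(ℝ) I (fun s => φ s x) t
    ((1 : ℝ →L[ℝ] ℝ).smulRight (Z (φ t x)))

/-- `(η ∧ dη ∧ dη)(V₀,...,V₄)` up to a positive constant factor, for a pointwise `1`-form
`η`; pointwise nonvanishing of this expression on frames is the contact condition in
dimension 5. -/
def contactEval (I : ModelWithCorners ℝ E H) {M : Type*} [TopologicalSpace M] [ChartedSpace H M]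
    [IsManifold I (⊤ : ℕ∞) M] (η : ∀ z : M, TangentSpace I z →ₗ[ℝ] ℝ)
    (V : Fin 5 → VF I M) : M → ℝ := fun z =>
  ∑ σ : Equiv.Perm (Fin 5), ((Equiv.Perm.sign σ : ℤ) : ℝ) *
    (η z (V (σ 0) z) * dOfFun I (fun U x => η x (U x)) (V (σ 1)) (V (σ 2)) z *
      dOfFun I (fun U x => η x (U x)) (V (σ 3)) (V (σ 4)) z)

section LieBracketOnManifold

open VectorField Topology Filter

/-- In the boundaryless case, `vfLie` is Mathlib's Lie bracket of vector fields. -/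
lemma vfLie_eq_mlieBracket [I.Boundaryless] (V W : VF I M) :
    vfLie I V W = mlieBracket I V W := by
  funext x
  have hpull : ∀ U : VF I M,
      (fun e => (mfderiv I 𝓘(ℝ, E) (extChartAt I x) ((extChartAt I x).symm e)
        (U ((extChartAt I x).symm e)) : E)) =ᶠ[𝓝 (extChartAt I x x)]
      (mpullbackWithin 𝓘(ℝ, E) I (extChartAt I x).symm U (range I)) := by
    intro U
    filter_upwards [extChartAt_target_mem_nhds (I := I) x] with e he
    rw [mpullbackWithin_apply, ContinuousLinearMap.inverse_eq
      (mfderivWithin_extChartAt_symm_comp_mfderiv_extChartAt he)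
      (mfderiv_extChartAt_comp_mfderivWithin_extChartAt_symm he)]
    rfl
  have hbr := Filter.EventuallyEq.lieBracket_vectorField_eq (𝕜 := ℝ) (hpull V) (hpull W)
  have hinv : (mfderiv I 𝓘(ℝ, E) (extChartAt I x) x).inverse =
      mfderiv 𝓘(ℝ, E) I (extChartAt I x).symm (extChartAt I x x) := by
    have h1 := mfderivWithin_extChartAt_symm_comp_mfderiv_extChartAt' (I := I)
      (mem_extChartAt_source (I := I) x)
    have h2 := mfderiv_extChartAt_comp_mfderivWithin_extChartAt_symm' (I := I)
      (mem_extChartAt_source (I := I) x)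
    rw [I.range_eq_univ, mfderivWithin_univ] at h1 h2
    exact ContinuousLinearMap.inverse_eq h2 h1
  rw [← mlieBracketWithin_univ, mlieBracketWithin_apply, hinv]
  simp only [I.range_eq_univ, preimage_univ, inter_univ]
  rw [I.range_eq_univ] at hbr
  exact congrArg (mfderiv 𝓘(ℝ, E) I (extChartAt I x).symm (extChartAt I x x))
    (hbr.trans (congrFun lieBracketWithin_univ.symm _))

lemma SmoothVF.mdifferentiableAt {V : VF I M} (hV : SmoothVF I V) (x : M) :
    MDifferentiableAt I I.tangent (fun x => (⟨x, V x⟩ : TangentBundle I M)) x :=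
  (hV x).mdifferentiableAt (by simp)

lemma SmoothFn.mdifferentiableAt {f : M → ℝ} (hf : SmoothFn I f) (x : M) :
    MDifferentiableAt I 𝓘(ℝ) f x :=
  (hf x).mdifferentiableAt (by simp)

lemma SmoothVF.add {V W : VF I M} (hV : SmoothVF I V) (hW : SmoothVF I W) :
    SmoothVF I (V + W) :=
  ContMDiff.add_section hV hW

lemma SmoothVF.smul {f : M → ℝ} {V : VF I M} (hf : SmoothFn I f) (hV : SmoothVF I V) :
    SmoothVF I (f • V) :=
  ContMDiff.smul_section hf hV

lemma SmoothVF.const_smul {V : VF I M} (c : ℝ) (hV : SmoothVF I V) :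
    SmoothVF I (c • V) :=
  ContMDiff.const_smul_section hV

variable [I.Boundaryless]

lemma vfLie_swap (V W : VF I M) (x : M) : vfLie I V W x = - vfLie I W V x := by
  simp only [vfLie_eq_mlieBracket]
  exact mlieBracket_swap_apply

lemma vfLie_eq_zero_of_eq_zero {V W : VF I M} {x : M} (hV : V x = 0) (hW : W x = 0) :
    vfLie I V W x = 0 := by
  rw [vfLie_eq_mlieBracket, ← mlieBracketWithin_univ]
  exact mlieBracketWithin_eq_zero_of_eq_zero hV hW

lemma vfLie_self (V : VF I M) (x : M) : vfLie I V V x = 0 := by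
  rw [vfLie_eq_mlieBracket, ← mlieBracketWithin_univ, mlieBracketWithin_self]
  rfl

variable [CompleteSpace E]

lemma SmoothVF.vfLie {V W : VF I M} (hV : SmoothVF I V) (hW : SmoothVF I W) :
    SmoothVF I (vfLie I V W) := by
  have : IsManifold I (minSmoothness ℝ 2) M := by
    rw [minSmoothness_of_isRCLikeNormedField]
    infer_instance
  have : IsManifold I ((⊤ : ℕ∞) + 1) M := by simpa using (inferInstance : IsManifold I (⊤ : ℕ∞) M)
  rw [vfLie_eq_mlieBracket]
  intro x
  exact ContMDiffAt.mlieBracket_vectorField (n := ⊤) (m := ⊤) (hV x) (hW x) (by simp)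

lemma vfLie_add_left {U V : VF I M} (W : VF I M) (hU : SmoothVF I U) (hV : SmoothVF I V) (x : M) :
    vfLie I (U + V) W x = vfLie I U W x + vfLie I V W x := by
  simp only [vfLie_eq_mlieBracket]
  exact mlieBracket_add_left (hU.mdifferentiableAt x) (hV.mdifferentiableAt x)

lemma vfLie_add_right (U : VF I M) {V W : VF I M} (hV : SmoothVF I V) (hW : SmoothVF I W) (x : M) :
    vfLie I U (V + W) x = vfLie I U V x + vfLie I U W x := by
  rw [vfLie_swap, vfLie_add_left U hV hW, vfLie_swap V, vfLie_swap W]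
  abel

/-- Leibniz rule for the Lie bracket. -/
lemma vfLie_smul_right {f : M → ℝ} (V : VF I M) {W : VF I M} (hf : SmoothFn I f)
    (hW : SmoothVF I W) (x : M) :
    vfLie I V (f • W) x = vderiv I V f x • W x + f x • vfLie I V W x := by
  simp only [vfLie_eq_mlieBracket]
  exact mlieBracket_smul_right (hf.mdifferentiableAt x) (hW.mdifferentiableAt x)

lemma vfLie_smul_left {f : M → ℝ} {V : VF I M} (W : VF I M) (hf : SmoothFn I f)
    (hV : SmoothVF I V) (x : M) :
    vfLie I (f • V) W x = -vderiv I W f x • V x + f x • vfLie I V W x := by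
  rw [vfLie_swap, vfLie_smul_right W hf hV, vfLie_swap W V]
  module

lemma vfLie_const_smul_right (c : ℝ) (V : VF I M) {W : VF I M} (hW : SmoothVF I W) (x : M) :
    vfLie I V (c • W) x = c • vfLie I V W x := by
  simp only [vfLie_eq_mlieBracket]
  exact mlieBracket_const_smul_right (hW.mdifferentiableAt x)

lemma vfLie_const_smul_left (c : ℝ) {V : VF I M} (W : VF I M) (hV : SmoothVF I V) (x : M) :
    vfLie I (c • V) W x = c • vfLie I V W x := by
  rw [vfLie_swap, vfLie_const_smul_right c W hV, vfLie_swap W V]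
  module

end LieBracketOnManifold

section DependentTriples

open VectorField Topology Filter

/-- If three vector fields are pointwise dependent and two of them vanish at a point `e`, then
their derivatives at `e` along the third one are dependent with it. -/
lemma not_linearIndependent_lieBracket_of_eventually {V W₁ W₂ : E → E} {e : E}
    (hV : ContinuousAt V e) (hW₁ : DifferentiableAt ℝ W₁ e) (hW₂ : DifferentiableAt ℝ W₂ e)
    (h₁ : W₁ e = 0) (h₂ : W₂ e = 0)
    (hdep : ∀ᶠ y in 𝓝 e, ¬ LinearIndependent ℝ ![V y, W₁ y, W₂ y]) :
    ¬ LinearIndependent ℝ ![V e, lieBracket ℝ V W₁ e, lieBracket ℝ V W₂ e] := by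
  intro hind
  have hline : Tendsto (fun t : ℝ => e + t • V e) (𝓝[≠] 0) (𝓝 e) := by
    have : ContinuousAt (fun t : ℝ => e + t • V e) 0 := by fun_prop
    have := this.tendsto
    simp only [zero_smul, add_zero] at this
    exact this.mono_left nhdsWithin_le_nhds
  have hlim : ∀ W : E → E, DifferentiableAt ℝ W e → W e = 0 →
      Tendsto (fun t : ℝ => t⁻¹ • W (e + t • V e)) (𝓝[≠] 0) (𝓝 (lieBracket ℝ V W e)) := by
    intro W hW hWe
    have hder : HasDerivAt (fun t : ℝ => W (e + t • V e)) (fderiv ℝ W e (V e)) 0 :=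
      (hW.hasFDerivAt.hasLineDerivAt (V e))
    have := hder.tendsto_slope_zero
    simpa [hWe, lieBracket] using this
  have htriple : Tendsto
      (fun t : ℝ => ![V (e + t • V e), t⁻¹ • W₁ (e + t • V e), t⁻¹ • W₂ (e + t • V e)]) (𝓝[≠] 0)
      (𝓝 ![V e, lieBracket ℝ V W₁ e, lieBracket ℝ V W₂ e]) := by
    rw [tendsto_pi_nhds]
    intro i
    fin_cases i
    · exact hV.tendsto.comp hline
    · exact hlim W₁ hW₁ h₁
    · exact hlim W₂ hW₂ h₂
  obtain ⟨t, hind_t, hdep_t, ht⟩ := ((htriple.eventually hind.eventually).and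
    ((hline.eventually hdep).and self_mem_nhdsWithin)).exists
  refine hdep_t ?_
  have ht' : t ≠ 0 := ht
  have hresc := hind_t.units_smul ![1, Units.mk0 t ht', Units.mk0 t ht']
  have heq : ![1, Units.mk0 t ht', Units.mk0 t ht'] •
      ![V (e + t • V e), t⁻¹ • W₁ (e + t • V e), t⁻¹ • W₂ (e + t • V e)] =
      ![V (e + t • V e), W₁ (e + t • V e), W₂ (e + t • V e)] := by
    funext i
    fin_cases i <;> simp [Units.smul_def, smul_smul, ht']
  exact heq ▸ hresc

lemma not_linearIndependent_vfLie_of_eq_zero [I.Boundaryless] [CompleteSpace E]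
    {V W₁ W₂ : VF I M} (hV : SmoothVF I V) (hW₁ : SmoothVF I W₁) (hW₂ : SmoothVF I W₂)
    (hdep : ∀ y, ¬ LinearIndependent ℝ ![V y, W₁ y, W₂ y])
    {x : M} (h₁ : W₁ x = 0) (h₂ : W₂ x = 0) :
    ¬ LinearIndependent ℝ ![V x, vfLie I V W₁ x, vfLie I V W₂ x] := by
  intro hind
  let e := extChartAt I x x
  let hat : VF I M → E → E := fun U =>
    mpullbackWithin 𝓘(ℝ, E) I (extChartAt I x).symm U (range I)
  have hdiff : ∀ U : VF I M, SmoothVF I U → DifferentiableAt ℝ (hat U) e := by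
    intro U hU
    have := (hU.mdifferentiableAt x).mdifferentiableWithinAt
      (s := univ) |>.differentiableWithinAt_mpullbackWithin_vectorField
    rw [preimage_univ, univ_inter] at this
    exact this.differentiableAt (by simp [I.range_eq_univ])
  have hzero : ∀ U : VF I M, U x = 0 → hat U e = 0 := by
    intro U hU
    change (mfderivWithin 𝓘(ℝ, E) I (extChartAt I x).symm (range I) e).inverse
      (U ((extChartAt I x).symm e)) = 0
    rw [extChartAt_to_inv, hU]
    exact map_zero _
  let L : E →L[ℝ] TangentSpace I x := (mfderiv I 𝓘(ℝ, E) (extChartAt I x) x).inverse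
  have hbr : ∀ U₁ U₂ : VF I M, vfLie I U₁ U₂ x = L (lieBracket ℝ (hat U₁) (hat U₂) e) := by
    intro U₁ U₂
    rw [vfLie_eq_mlieBracket, ← mlieBracketWithin_univ, mlieBracketWithin_apply]
    simp only [I.range_eq_univ, preimage_univ, inter_univ, hat, L]
    exact congrArg _ (congrFun lieBracketWithin_univ _)
  have hval : ∀ U : VF I M, U x = L (hat U e) := by
    intro U
    have h := mfderiv_extChartAt_inverse_comp_mfderivWithin_extChartAT_symm (I := I) (U x)
    change _ = L ((mfderivWithin 𝓘(ℝ, E) I (extChartAt I x).symm (range I) e).inverse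
      (U ((extChartAt I x).symm e)))
    rw [extChartAt_to_inv]
    exact h.symm
  refine not_linearIndependent_lieBracket_of_eventually (hdiff V hV).continuousAt (hdiff W₁ hW₁)
    (hdiff W₂ hW₂) (hzero W₁ h₁) (hzero W₂ h₂) ?_ (LinearIndependent.of_comp L.toLinearMap ?_)
  · refine Eventually.of_forall fun y hy => hdep ((extChartAt I x).symm y) ?_
    refine LinearIndependent.of_comp
      (mfderivWithin 𝓘(ℝ, E) I (extChartAt I x).symm (range I) y).inverse.toLinearMap ?_
    have heq : (mfderivWithin 𝓘(ℝ, E) I (extChartAt I x).symm (range I) y).inverse.toLinearMap ∘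
        ![V ((extChartAt I x).symm y), W₁ ((extChartAt I x).symm y),
          W₂ ((extChartAt I x).symm y)] = ![hat V y, hat W₁ y, hat W₂ y] := by
      funext i
      fin_cases i <;> rfl
    exact heq ▸ hy
  · have heq : ![V x, vfLie I V W₁ x, vfLie I V W₂ x] = L.toLinearMap ∘
        ![hat V e, lieBracket ℝ (hat V) (hat W₁) e, lieBracket ℝ (hat V) (hat W₂) e] := by
      funext i
      fin_cases i
      · exact hval V
      · exact hbr V W₁
      · exact hbr V W₂
    exact heq ▸ hind

end DependentTriples

section SpanningSections

lemma mem_span_pair_of_not_linearIndependent {F : Type*} [AddCommGroup F] [Module ℝ F] {a b c : F}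
    (hab : LinearIndependent ℝ ![a, b]) (habc : ¬ LinearIndependent ℝ ![a, b, c]) :
    c ∈ Submodule.span ℝ {a, b} := by
  by_contra hc
  refine habc ?_
  have hcab : LinearIndependent ℝ ![c, a, b] :=
    linearIndependent_finCons.2 ⟨hab, by rwa [Matrix.range_cons_cons_empty]⟩
  have hperm := hcab.comp ![1, 2, 0] (by decide)
  have heq : ![c, a, b] ∘ ![1, 2, 0] = ![a, b, c] := by
    funext i
    fin_cases i <;> rfl
  exact heq ▸ hperm

lemma not_linearIndependent_of_finrank_eq_two {F : Type*} [AddCommGroup F] [Module ℝ F]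
    {P : Submodule ℝ F} (hP : finrank ℝ P = 2) {a b c : F} (ha : a ∈ P) (hb : b ∈ P) (hc : c ∈ P) :
    ¬ LinearIndependent ℝ ![a, b, c] := by
  intro h
  have : Module.Finite ℝ P := Module.finite_of_finrank_eq_succ hP
  have hle : Submodule.span ℝ (range ![a, b, c]) ≤ P := by
    rw [Submodule.span_le, range_subset_iff]
    intro i
    fin_cases i <;> assumption
  have := Submodule.finrank_mono hle
  rw [finrank_span_eq_card h, hP] at this
  simp at this

lemma IsSection.add {D : TangentDist I M} {V W : VF I M} (hV : IsSection I D V)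
    (hW : IsSection I D W) : IsSection I D (V + W) :=
  ⟨hV.1.add hW.1, fun x => (D x).add_mem (hV.2 x) (hW.2 x)⟩

lemma IsSection.const_smul {D : TangentDist I M} {V : VF I M} (c : ℝ) (hV : IsSection I D V) :
    IsSection I D (c • V) :=
  ⟨hV.1.const_smul c, fun x => (D x).smul_mem c (hV.2 x)⟩

variable [I.Boundaryless] [CompleteSpace E]

/-- Near a point where the derived distribution of a plane field has rank three, the plane field
is spanned by two of its sections. -/
lemma exists_isSection_linearIndependent {D : TangentDist I M} (hD : ∀ y, finrank ℝ (D y) = 2)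
    {x : M} (hx : finrank ℝ (derivedDist I D x) = 3) :
    ∃ U V, IsSection I D U ∧ IsSection I D V ∧ LinearIndependent ℝ ![U x, V x] := by
  by_contra! hcon
  suffices h : ∃ a b : TangentSpace I x, derivedDist I D x ≤ Submodule.span ℝ {a, b} by
    obtain ⟨a, b, hab⟩ := h
    have hfin : Module.Finite ℝ (Submodule.span ℝ {a, b}) :=
      Module.Finite.span_of_finite ℝ (Set.toFinite _)
    have hrank := Submodule.finrank_mono hab
    have hcard : finrank ℝ (Submodule.span ℝ {a, b}) ≤ 2 := by
      classical
      have := finrank_span_finset_le_card (R := ℝ) ({a, b} : Finset (TangentSpace I x))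
      rw [Finset.coe_pair] at this
      exact this.trans Finset.card_le_two
    omega
  by_cases hV : ∃ V, IsSection I D V ∧ V x ≠ 0
  swap
  · push Not at hV
    refine ⟨0, 0, Submodule.span_le.2 ?_⟩
    rintro v (⟨V, hVD, rfl⟩ | ⟨V, W, hVD, hWD, rfl⟩)
    · simp [hV V hVD]
    · simp [vfLie_eq_zero_of_eq_zero (hV V hVD) (hV W hWD)]
  obtain ⟨V, hVD, hVx⟩ := hV
  have hsplit : ∀ W, IsSection I D W →
      ∃ (c : ℝ) (Z : VF I M), IsSection I D Z ∧ Z x = 0 ∧ W = c • V + Z := by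
    intro W hWD
    have hdep := hcon V W hVD hWD
    rw [LinearIndependent.pair_iff' hVx] at hdep
    push Not at hdep
    obtain ⟨c, hc⟩ := hdep
    refine ⟨c, W + (-c) • V, hWD.add (hVD.const_smul _), ?_, ?_⟩
    · change W x + (-c) • V x = 0
      rw [← hc]
      module
    · module
  obtain ⟨s, hs⟩ : ∃ s : TangentSpace I x, ∀ Z, IsSection I D Z → Z x = 0 →
      vfLie I V Z x ∈ Submodule.span ℝ {V x, s} := by
    by_cases hall : ∀ Z, IsSection I D Z → Z x = 0 → vfLie I V Z x ∈ Submodule.span ℝ {V x}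
    · exact ⟨0, fun Z hZ hZx => Submodule.span_mono (by simp) (hall Z hZ hZx)⟩
    · push Not at hall
      obtain ⟨Z₀, hZ₀, hZ₀x, hns⟩ := hall
      refine ⟨vfLie I V Z₀ x, fun Z hZ hZx => mem_span_pair_of_not_linearIndependent ?_ ?_⟩
      · rw [LinearIndependent.pair_iff' hVx]
        exact fun c hc => hns (Submodule.mem_span_singleton.2 ⟨c, hc⟩)
      · exact not_linearIndependent_vfLie_of_eq_zero hVD.1 hZ₀.1 hZ.1
          (fun y => not_linearIndependent_of_finrank_eq_two (hD y) (hVD.2 y) (hZ₀.2 y) (hZ.2 y))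
          hZ₀x hZx
  refine ⟨V x, s, Submodule.span_le.2 ?_⟩
  have hVmem : V x ∈ Submodule.span ℝ {V x, s} := Submodule.subset_span (by simp)
  rintro v (⟨W, hWD, rfl⟩ | ⟨W₁, W₂, hW₁D, hW₂D, rfl⟩)
  · obtain ⟨c, Z, -, hZx, rfl⟩ := hsplit W hWD
    change c • V x + Z x ∈ Submodule.span ℝ {V x, s}
    rw [hZx, add_zero]
    exact Submodule.smul_mem _ c hVmem
  · obtain ⟨c₁, Z₁, hZ₁, hZ₁x, rfl⟩ := hsplit W₁ hW₁D
    obtain ⟨c₂, Z₂, hZ₂, hZ₂x, rfl⟩ := hsplit W₂ hW₂D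
    have hbr : vfLie I (c₁ • V + Z₁) (c₂ • V + Z₂) x =
        c₁ • vfLie I V Z₂ x - c₂ • vfLie I V Z₁ x := by
      rw [vfLie_add_left _ (hVD.1.const_smul c₁) hZ₁.1,
        vfLie_add_right _ (hVD.1.const_smul c₂) hZ₂.1,
        vfLie_add_right _ (hVD.1.const_smul c₂) hZ₂.1,
        vfLie_const_smul_left c₁ _ hVD.1, vfLie_const_smul_left c₁ _ hVD.1,
        vfLie_const_smul_right c₂ _ hVD.1, vfLie_const_smul_right c₂ _ hVD.1,
        vfLie_self, vfLie_eq_zero_of_eq_zero hZ₁x hZ₂x, vfLie_swap Z₁ V]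
      module
    rw [hbr]
    exact Submodule.sub_mem _ (Submodule.smul_mem _ _ (hs Z₂ hZ₂ hZ₂x))
      (Submodule.smul_mem _ _ (hs Z₁ hZ₁ hZ₁x))

end SpanningSections

section AlternatingOnPlanes

variable {F : Type*} [AddCommGroup F] [Module ℝ F]

lemma alternating_two_add_left (ω : F [⋀^Fin 2]→ₗ[ℝ] ℝ) (a b c : F) :
    ω ![a + b, c] = ω ![a, c] + ω ![b, c] :=
  ω.map_vecCons_add ![c] a b

lemma alternating_two_smul_left (ω : F [⋀^Fin 2]→ₗ[ℝ] ℝ) (r : ℝ) (a c : F) :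
    ω ![r • a, c] = r * ω ![a, c] :=
  ω.map_vecCons_smul ![c] r a

lemma alternating_two_swap (ω : F [⋀^Fin 2]→ₗ[ℝ] ℝ) (a b : F) : ω ![a, b] = - ω ![b, a] := by
  rw [← ω.map_swap ![b, a] (i := 0) (j := 1) (by decide)]
  congr 1
  funext i
  fin_cases i <;> rfl

lemma alternating_two_add_right (ω : F [⋀^Fin 2]→ₗ[ℝ] ℝ) (a b c : F) :
    ω ![a, b + c] = ω ![a, b] + ω ![a, c] := by
  rw [alternating_two_swap, alternating_two_add_left, alternating_two_swap ω b,
    alternating_two_swap ω c]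
  ring

lemma alternating_two_smul_right (ω : F [⋀^Fin 2]→ₗ[ℝ] ℝ) (r : ℝ) (a b : F) :
    ω ![a, r • b] = r * ω ![a, b] := by
  rw [alternating_two_swap, alternating_two_smul_left, alternating_two_swap ω b]
  ring

lemma alternating_two_self (ω : F [⋀^Fin 2]→ₗ[ℝ] ℝ) (a : F) : ω ![a, a] = 0 :=
  ω.map_eq_zero_of_eq _ (i := 0) (j := 1) rfl (by decide)

lemma linearIndependent_of_alternating_ne_zero {ω : F [⋀^Fin 2]→ₗ[ℝ] ℝ} {u v : F}
    (h : ω ![u, v] ≠ 0) : LinearIndependent ℝ ![u, v] := by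
  by_contra hdep
  exact h (ω.map_linearDependent _ hdep)

lemma span_pair_eq_of_finrank_eq_two {P : Submodule ℝ F} (hP : finrank ℝ P = 2)
    {u v : F} (hu : u ∈ P) (hv : v ∈ P)
    (huv : LinearIndependent ℝ ![u, v]) : Submodule.span ℝ {u, v} = P := by
  refine le_antisymm (Submodule.span_le.2 (Set.pair_subset hu hv)) fun w hw => ?_
  exact mem_span_pair_of_not_linearIndependent huv
    (not_linearIndependent_of_finrank_eq_two hP hu hv hw)

lemma exists_coeff_of_finrank_eq_two {P : Submodule ℝ F} (hP : finrank ℝ P = 2)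
    {u v w : F} (hu : u ∈ P) (hv : v ∈ P) (hw : w ∈ P)
    (huv : LinearIndependent ℝ ![u, v]) : ∃ a b : ℝ, w = a • u + b • v := by
  rw [← span_pair_eq_of_finrank_eq_two hP hu hv huv, Submodule.mem_span_pair] at hw
  obtain ⟨a, b, h⟩ := hw
  exact ⟨a, b, h.symm⟩

/-- Cramer's rule in a plane. -/
lemma alternating_smul_eq_of_finrank_eq_two {P : Submodule ℝ F}
    (hP : finrank ℝ P = 2) (ω : F [⋀^Fin 2]→ₗ[ℝ] ℝ) {u v w : F}
    (hu : u ∈ P) (hv : v ∈ P) (hw : w ∈ P) :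
    ω ![u, v] • w = ω ![w, v] • u + ω ![u, w] • v := by
  by_cases huv : LinearIndependent ℝ ![u, v]
  · obtain ⟨a, b, rfl⟩ := exists_coeff_of_finrank_eq_two hP hu hv hw huv
    simp only [alternating_two_add_left, alternating_two_smul_left, alternating_two_add_right,
      alternating_two_smul_right, alternating_two_self]
    module
  · rw [ω.map_linearDependent _ huv]
    by_cases hu0 : u = 0
    · have hz : ω ![u, w] = 0 := ω.map_coord_zero 0 hu0
      rw [hz, hu0]
      simp
    · rw [LinearIndependent.pair_iff' hu0] at huv
      push Not at huv
      obtain ⟨a, rfl⟩ := huv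
      rw [alternating_two_smul_right, alternating_two_swap ω w u]
      module

/-- Two alternating forms on a plane are proportional. -/
lemma alternating_mul_comm_of_finrank_eq_two {P : Submodule ℝ F}
    (hP : finrank ℝ P = 2) (ω ψ : F [⋀^Fin 2]→ₗ[ℝ] ℝ) {u v u' v' : F}
    (hu : u ∈ P) (hv : v ∈ P) (hu' : u' ∈ P) (hv' : v' ∈ P) :
    ω ![u, v] * ψ ![u', v'] = ω ![u', v'] * ψ ![u, v] := by
  by_cases huv : LinearIndependent ℝ ![u, v]
  · obtain ⟨a, b, rfl⟩ := exists_coeff_of_finrank_eq_two hP hu hv hu' huv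
    obtain ⟨c, d, rfl⟩ := exists_coeff_of_finrank_eq_two hP hu hv hv' huv
    simp only [alternating_two_add_left, alternating_two_smul_left, alternating_two_add_right,
      alternating_two_smul_right, alternating_two_self, alternating_two_swap _ v u]
    ring
  · rw [ω.map_linearDependent _ huv, ψ.map_linearDependent _ huv]
    ring

end AlternatingOnPlanes

section OrientedPlaneFields

lemma FormPt.smoothFn_two (ω : FormPt I M 2) {U V : VF I M} (hU : SmoothVF I U)
    (hV : SmoothVF I V) : SmoothFn I (fun x => ω.val x ![U x, V x]) := by
  have h := ω.smooth' ![U, V] (fun i => by fin_cases i <;> assumption)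
  convert h using 3 with x
  funext i
  fin_cases i <;> rfl

lemma FormPt.smoothFn_four (ω : FormPt I M 4) {A B U V : VF I M} (hA : SmoothVF I A)
    (hB : SmoothVF I B) (hU : SmoothVF I U) (hV : SmoothVF I V) :
    SmoothFn I (fun x => ω.val x ![A x, B x, U x, V x]) := by
  have h := ω.smooth' ![A, B, U, V] (fun i => by fin_cases i <;> assumption)
  convert h using 3 with x
  funext i
  fin_cases i <;> rfl

variable [I.Boundaryless] [CompleteSpace E]

lemma vfLie_smul_smul_sub_mem {D : TangentDist I M} {U V : VF I M} {f g : M → ℝ}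
    (hU : IsSection I D U) (hV : IsSection I D V) (hf : SmoothFn I f) (hg : SmoothFn I g)
    (x : M) : vfLie I (f • U) (g • V) x - (f x * g x) • vfLie I U V x ∈ D x := by
  have h : vfLie I (f • U) (g • V) x - (f x * g x) • vfLie I U V x =
      (-vderiv I (g • V) f x) • U x + (f x * vderiv I U g x) • V x := by
    rw [vfLie_smul_left _ hf hU.1, vfLie_smul_right _ hg hV.1]
    module
  rw [h]
  exact (D x).add_mem ((D x).smul_mem _ (hU.2 x)) ((D x).smul_mem _ (hV.2 x))

/-- Modulo the plane field, the Lie bracket of two sections only depends on their oriented area. -/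
lemma vfLie_sub_mem_of_form {D : TangentDist I M} (hD : ∀ y, finrank ℝ (D y) = 2)
    (ω : FormPt I M 2) {U V U' V' : VF I M} (hU : IsSection I D U) (hV : IsSection I D V)
    (hU' : IsSection I D U') (hV' : IsSection I D V') {x : M}
    (hx : ω.val x ![U x, V x] ≠ 0) :
    ω.val x ![U x, V x] • vfLie I U' V' x - ω.val x ![U' x, V' x] • vfLie I U V x ∈ D x := by
  set f : M → ℝ := fun y => ω.val y ![U y, V y] with hf_def
  set g : M → ℝ := fun y => ω.val y ![U' y, V y] with hg_def
  set h : M → ℝ := fun y => ω.val y ![U y, U' y] with hh_def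
  set k : M → ℝ := fun y => ω.val y ![V' y, V y] with hk_def
  set l : M → ℝ := fun y => ω.val y ![U y, V' y] with hl_def
  have hf : SmoothFn I f := ω.smoothFn_two hU.1 hV.1
  have hg : SmoothFn I g := ω.smoothFn_two hU'.1 hV.1
  have hh : SmoothFn I h := ω.smoothFn_two hU.1 hU'.1
  have hk : SmoothFn I k := ω.smoothFn_two hV'.1 hV.1
  have hl : SmoothFn I l := ω.smoothFn_two hU.1 hV'.1
  have hfU' : f • U' = g • U + h • V := funext fun y =>
    alternating_smul_eq_of_finrank_eq_two (hD y) (ω.val y) (hU.2 y) (hV.2 y) (hU'.2 y)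
  have hfV' : f • V' = k • U + l • V := funext fun y =>
    alternating_smul_eq_of_finrank_eq_two (hD y) (ω.val y) (hU.2 y) (hV.2 y) (hV'.2 y)
  have hdet : f x * ω.val x ![U' x, V' x] = g x * l x - h x * k x := by
    have hx' : f x • U' x = g x • U x + h x • V x := congrFun hfU' x
    rw [← alternating_two_smul_left, hx', alternating_two_add_left, alternating_two_smul_left,
      alternating_two_smul_left, alternating_two_swap _ (V x)]
    simp only [hl_def, hk_def]
    ring
  have hexp : vfLie I (f • U') (f • V') x = vfLie I (g • U) (k • U) x + vfLie I (g • U) (l • V) x +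
      (vfLie I (h • V) (k • U) x + vfLie I (h • V) (l • V) x) := by
    rw [hfU', hfV', vfLie_add_left _ (hU.1.smul hg) (hV.1.smul hh),
      vfLie_add_right _ (hU.1.smul hk) (hV.1.smul hl),
      vfLie_add_right _ (hU.1.smul hk) (hV.1.smul hl)]
  have h₀ := vfLie_smul_smul_sub_mem hU' hV' hf hf x
  have h₁ := vfLie_smul_smul_sub_mem hU hU hg hk x
  have h₂ := vfLie_smul_smul_sub_mem hU hV hg hl x
  have h₃ := vfLie_smul_smul_sub_mem hV hU hh hk x
  have h₄ := vfLie_smul_smul_sub_mem hV hV hh hl x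
  rw [hexp] at h₀
  rw [vfLie_self] at h₁ h₄
  rw [vfLie_swap V U] at h₃
  have hsum := (D x).sub_mem ((D x).add_mem ((D x).add_mem h₁ h₂) ((D x).add_mem h₃ h₄)) h₀
  rw [← (D x).smul_mem_iff hx]
  convert hsum using 1
  have : (ω.val x ![U x, V x] * ω.val x ![U' x, V' x]) • vfLie I U V x =
      (g x * l x - h x * k x) • vfLie I U V x := by rw [← hdet]
  rw [smul_sub, smul_smul, smul_smul, this]
  module

lemma exists_isSection_form_ne_zero {D : TangentDist I M} (hD : ∀ y, finrank ℝ (D y) = 2)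
    (ω : FormPt I M 2) {x : M} (hx : finrank ℝ (derivedDist I D x) = 3)
    (hω : ∃ u v, u ∈ D x ∧ v ∈ D x ∧ ω.val x ![u, v] ≠ 0) :
    ∃ U V, IsSection I D U ∧ IsSection I D V ∧ ω.val x ![U x, V x] ≠ 0 := by
  obtain ⟨U, V, hU, hV, hUV⟩ := exists_isSection_linearIndependent hD hx
  obtain ⟨u, v, hu, hv, huv⟩ := hω
  refine ⟨U, V, hU, hV, fun hzero => huv ?_⟩
  obtain ⟨a, b, rfl⟩ := exists_coeff_of_finrank_eq_two (hD x) (hU.2 x) (hV.2 x) hu hUV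
  obtain ⟨c, d, rfl⟩ := exists_coeff_of_finrank_eq_two (hD x) (hU.2 x) (hV.2 x) hv hUV
  simp only [alternating_two_add_left, alternating_two_smul_left, alternating_two_add_right,
    alternating_two_smul_right, alternating_two_self, alternating_two_swap _ (V x) (U x), hzero]
  ring

/-- A local frame of the derived distribution. -/
lemma derivedDist_eq_span_of_form {D : TangentDist I M} (hD : ∀ y, finrank ℝ (D y) = 2)
    (ω : FormPt I M 2) {U V : VF I M} (hU : IsSection I D U) (hV : IsSection I D V) {x : M}
    (hx : ω.val x ![U x, V x] ≠ 0) :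
    derivedDist I D x = Submodule.span ℝ (range ![vfLie I U V x, U x, V x]) := by
  set S := Submodule.span ℝ (range ![vfLie I U V x, U x, V x]) with hS
  have hmem : ∀ i, ![vfLie I U V x, U x, V x] i ∈ S := fun i =>
    Submodule.subset_span (mem_range_self i)
  have hDS : D x ≤ S := by
    rw [← span_pair_eq_of_finrank_eq_two (hD x) (hU.2 x) (hV.2 x)
      (linearIndependent_of_alternating_ne_zero hx), Submodule.span_le]
    exact Set.pair_subset (hmem 1) (hmem 2)
  refine le_antisymm (Submodule.span_le.2 ?_) (Submodule.span_le.2 ?_)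
  · rintro v (⟨W, hW, rfl⟩ | ⟨W₁, W₂, hW₁, hW₂, rfl⟩)
    · exact hDS (hW.2 x)
    · have h := S.add_mem (hDS (vfLie_sub_mem_of_form hD ω hU hV hW₁ hW₂ hx))
        (S.smul_mem (ω.val x ![W₁ x, W₂ x]) (hmem 0))
      rw [SetLike.mem_coe, ← S.smul_mem_iff hx]
      convert h using 1
      exact (sub_add_cancel _ _).symm
  · rintro v ⟨i, rfl⟩
    refine Submodule.subset_span ?_
    fin_cases i
    exacts [Or.inr ⟨U, V, hU, hV, rfl⟩, Or.inl ⟨U, hU, rfl⟩, Or.inl ⟨V, hV, rfl⟩]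

lemma linearIndependent_vfLie_of_form {D : TangentDist I M} (hD : ∀ y, finrank ℝ (D y) = 2)
    (ω : FormPt I M 2) {U V : VF I M} (hU : IsSection I D U) (hV : IsSection I D V) {x : M}
    (hx : ω.val x ![U x, V x] ≠ 0) (hrank : finrank ℝ (derivedDist I D x) = 3) :
    LinearIndependent ℝ ![vfLie I U V x, U x, V x] := by
  rw [linearIndependent_iff_card_eq_finrank_span, Set.finrank,
    ← derivedDist_eq_span_of_form hD ω hU hV hx, hrank]
  rfl

end OrientedPlaneFields

section VolumeForms

variable {F : Type*} [AddCommGroup F] [Module ℝ F]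

lemma alternating_four_ne_zero (hF : finrank ℝ F = 4) {ν : F [⋀^Fin 4]→ₗ[ℝ] ℝ} (hν : ν ≠ 0)
    {v : Fin 4 → F} (hv : LinearIndependent ℝ v) : ν v ≠ 0 := by
  have hb := coe_basisOfLinearIndependentOfCardEqFinrank hv (by simp [hF])
  rw [← hb]
  exact (ν.map_basis_ne_zero_iff _).2 hν

/-- An alternating form as a linear form in its first variable. -/
def alternatingInFirst {n : ℕ} (ν : F [⋀^Fin (n + 1)]→ₗ[ℝ] ℝ) (w : Fin n → F) : F →ₗ[ℝ] ℝ where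
  toFun y := ν (Matrix.vecCons y w)
  map_add' := ν.map_vecCons_add w
  map_smul' c y := ν.map_vecCons_smul w c y

lemma alternatingInFirst_apply {n : ℕ} (ν : F [⋀^Fin (n + 1)]→ₗ[ℝ] ℝ) (w : Fin n → F) (y : F) :
    alternatingInFirst ν w y = ν (Matrix.vecCons y w) := rfl

/-- The kernel of an alternating form with all but one entry fixed and independent. -/
lemma ker_alternatingInFirst (hF : finrank ℝ F = 4) {ν : F [⋀^Fin 4]→ₗ[ℝ] ℝ} (hν : ν ≠ 0)
    {w : Fin 3 → F} (hw : LinearIndependent ℝ w) :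
    LinearMap.ker (alternatingInFirst ν w) = Submodule.span ℝ (range w) := by
  ext y
  rw [LinearMap.mem_ker, alternatingInFirst_apply]
  constructor
  · intro hy
    by_contra hyw
    exact alternating_four_ne_zero hF hν (linearIndependent_finCons.2 ⟨hw, hyw⟩) hy
  · intro hy
    exact ν.map_linearDependent _ fun h => (linearIndependent_finCons.1 h).2 hy

lemma alternating_four_eq_zero_of_finrank_eq_two {P : Submodule ℝ F} (hP : finrank ℝ P = 2)
    (ν : F [⋀^Fin 4]→ₗ[ℝ] ℝ) (y : F) {d u v : F} (hd : d ∈ P) (hu : u ∈ P) (hv : v ∈ P) :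
    ν ![y, d, u, v] = 0 :=
  ν.map_linearDependent _ fun h =>
    not_linearIndependent_of_finrank_eq_two hP hd hu hv (linearIndependent_finCons.1 h).1

lemma alternating_four_mul_comm_of_finrank_eq_two {P : Submodule ℝ F} (hP : finrank ℝ P = 2)
    (ω : F [⋀^Fin 2]→ₗ[ℝ] ℝ) (ν : F [⋀^Fin 4]→ₗ[ℝ] ℝ) (y z : F) {u v u' v' : F}
    (hu : u ∈ P) (hv : v ∈ P) (hu' : u' ∈ P) (hv' : v' ∈ P) :
    ω ![u, v] * ν ![y, z, u', v'] = ω ![u', v'] * ν ![y, z, u, v] :=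
  alternating_mul_comm_of_finrank_eq_two hP ω ((ν.curryLeft y).curryLeft z) hu hv hu' hv'

end VolumeForms

section Gluing

open Topology

/-- One-forms can be defined locally. -/
lemma exists_oneForm_of_local {ι : Type*} (φ : ι → ∀ x : M, TangentSpace I x →ₗ[ℝ] ℝ)
    (p : ι → M → Prop) (hcover : ∀ x, ∃ i, p i x)
    (hopen : ∀ i x, p i x → ∀ᶠ y in 𝓝 x, p i y)
    (hagree : ∀ i j x, p i x → p j x → φ i x = φ j x)
    (hsmooth : ∀ i x, p i x → ∀ V, SmoothVF I V →
      ContMDiffAt I 𝓘(ℝ) (⊤ : ℕ∞) (fun y => φ i y (V y)) x) :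
    ∃ α : OneForm I M, ∀ i x, p i x → α.val x = φ i x := by
  choose i hi using hcover
  have hα : ∀ j x, p j x → φ (i x) x = φ j x := fun j x hj => hagree _ _ x (hi x) hj
  refine ⟨⟨fun x => φ (i x) x, fun V hV x => ?_⟩, hα⟩
  refine (hsmooth (i x) x (hi x) V hV).congr_of_eventuallyEq ?_
  filter_upwards [hopen (i x) x (hi x)] with y hy
  rw [hα _ _ hy]

/-- The locally defined one-forms `ω(U, V)⁻ⁿ ν(·, B(U, V), U, V)`, for sections `U`, `V` of a plane
field, glue if they do not depend on `U` and `V`. -/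
lemma exists_oneForm_of_sections {D : TangentDist I M} (ω : FormPt I M 2) (ν : FormPt I M 4) (n : ℕ)
    (B : VF I M → VF I M → VF I M)
    (hB : ∀ U V, IsSection I D U → IsSection I D V → SmoothVF I (B U V))
    (hcover : ∀ x, ∃ U V, IsSection I D U ∧ IsSection I D V ∧ ω.val x ![U x, V x] ≠ 0)
    (hagree : ∀ U V U' V' x, IsSection I D U → IsSection I D V → IsSection I D U' →
      IsSection I D V' → ω.val x ![U x, V x] ≠ 0 → ω.val x ![U' x, V' x] ≠ 0 → ∀ y,
      ω.val x ![U x, V x] ^ n * ν.val x ![y, B U' V' x, U' x, V' x] =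
        ω.val x ![U' x, V' x] ^ n * ν.val x ![y, B U V x, U x, V x]) :
    ∃ α : OneForm I M, ∀ U V x, IsSection I D U → IsSection I D V → ω.val x ![U x, V x] ≠ 0 →
      LinearMap.ker (α.val x) =
        LinearMap.ker (alternatingInFirst (ν.val x) ![B U V x, U x, V x]) := by
  refine (exists_oneForm_of_local (I := I) (M := M)
    (ι := {q : VF I M × VF I M // IsSection I D q.1 ∧ IsSection I D q.2})
    (fun q x => (ω.val x ![q.1.1 x, q.1.2 x] ^ n)⁻¹ •
      alternatingInFirst (ν.val x) ![B q.1.1 q.1.2 x, q.1.1 x, q.1.2 x])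
    (fun q x => ω.val x ![q.1.1 x, q.1.2 x] ≠ 0) ?_ ?_ ?_ ?_).imp
    fun α hα U V x hU hV hx => ?_
  · intro x
    obtain ⟨U, V, hU, hV, hx⟩ := hcover x
    exact ⟨⟨(U, V), hU, hV⟩, hx⟩
  · rintro ⟨⟨U, V⟩, hU, hV⟩ x hx
    exact (ω.smoothFn_two hU.1 hV.1).continuous.continuousAt.eventually_ne hx
  · rintro ⟨⟨U, V⟩, hU, hV⟩ ⟨⟨U', V'⟩, hU', hV'⟩ x hx hx'
    ext y
    have h := hagree U V U' V' x hU hV hU' hV' hx hx' y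
    simp only [LinearMap.smul_apply, alternatingInFirst_apply, smul_eq_mul]
    rw [inv_mul_eq_div, inv_mul_eq_div, div_eq_div_iff (pow_ne_zero _ hx) (pow_ne_zero _ hx')]
    linear_combination -h
  · rintro ⟨⟨U, V⟩, hU, hV⟩ x hx W hW
    have hden := ((ω.smoothFn_two hU.1 hV.1).pow n).contMDiffAt (x := x)
    exact (hden.inv₀ (pow_ne_zero _ hx)).mul
      (ν.smoothFn_four hW (hB U V hU hV) hU.1 hV.1).contMDiffAt
  · rw [hα ⟨(U, V), hU, hV⟩ x hx]
    exact LinearMap.ker_smul _ _ (inv_ne_zero (pow_ne_zero _ hx))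

end Gluing

section Frames

/-- The vector field dual to a one-form with respect to the metric making a frame orthonormal. -/
def OneForm.dualVF {n : ℕ} (F : Fin n → VF I M) (α : OneForm I M) : VF I M :=
  fun x => ∑ i, α.val x (F i x) • F i x

lemma OneForm.smoothVF_dualVF {n : ℕ} {F : Fin n → VF I M} (hF : ∀ i, SmoothVF I (F i))
    (α : OneForm I M) : SmoothVF I (α.dualVF F) :=
  ContMDiff.sum_section fun i _ => ContMDiff.smul_section (α.smooth' _ (hF i)) (hF i)

lemma linearMap_eq_zero_of_sum_sq {V : Type*} [AddCommGroup V] [Module ℝ V] {n : ℕ} [NeZero n]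
    (hV : finrank ℝ V = n) {v : Fin n → V} (hv : LinearIndependent ℝ v) {φ : V →ₗ[ℝ] ℝ}
    (h : ∑ i, φ (v i) ^ 2 = 0) : φ = 0 := by
  rw [Finset.sum_eq_zero_iff_of_nonneg fun i _ => sq_nonneg _] at h
  have hb := coe_basisOfLinearIndependentOfCardEqFinrank hv (by simp [hV])
  refine (basisOfLinearIndependentOfCardEqFinrank hv (by simp [hV])).ext fun i => ?_
  rw [hb]
  simpa using h i (Finset.mem_univ i)

/-- A basis of a plane completes two vectors that are independent modulo the plane. -/
lemma exists_linearIndependent_of_finrank_eq_two {V : Type*} [AddCommGroup V] [Module ℝ V]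
    {P : Submodule ℝ V} (hP : finrank ℝ P = 2) {a b : V}
    (hab : ∀ s t : ℝ, s • a + t • b ∈ P → s = 0 ∧ t = 0) :
    ∃ u v, u ∈ P ∧ v ∈ P ∧ LinearIndependent ℝ ![a, b, u, v] := by
  have : Module.Finite ℝ P := Module.finite_of_finrank_eq_succ hP
  let e := finBasisOfFinrankEq ℝ P hP
  have he : LinearIndependent ℝ ![(e 0 : V), (e 1 : V)] := by
    have h := e.linearIndependent.map' P.subtype P.ker_subtype
    have heq : P.subtype ∘ e = ![(e 0 : V), (e 1 : V)] := by
      funext i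
      fin_cases i <;> rfl
    exact heq ▸ h
  have hspan : Submodule.span ℝ (range ![(e 0 : V), (e 1 : V)]) = P := by
    rw [Matrix.range_cons_cons_empty]
    exact span_pair_eq_of_finrank_eq_two hP (e 0).2 (e 1).2 he
  refine ⟨e 0, e 1, (e 0).2, (e 1).2,
    linearIndependent_finCons.2 ⟨linearIndependent_finCons.2 ⟨he, ?_⟩, ?_⟩⟩
  · intro h
    rw [hspan] at h
    exact one_ne_zero (hab 0 1 (by simpa using h)).2
  · intro h
    change a ∈ Submodule.span ℝ (range ![b, (e 0 : V), (e 1 : V)]) at h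
    rw [Matrix.range_cons, Set.singleton_union, Submodule.mem_span_insert, hspan] at h
    obtain ⟨c, z, hz, rfl⟩ := h
    refine one_ne_zero (hab 1 (-c) ?_).1
    convert hz using 1
    module

/-- A two-form orienting a plane field cut out by Engel defining forms. -/
lemma exists_form_of_engelDefiningForms {D : TangentDist I M} (hD : IsEngel I D)
    (hE : ∀ x : M, finrank ℝ (TangentSpace I x) = 4) {F : Fin 4 → VF I M} (hF : ∀ i, SmoothVF I (F i))
    (hFx : ∀ x, LinearIndependent ℝ (fun i => F i x)) {ν : FormPt I M 4} (hν : ∀ x, ν.val x ≠ 0)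
    {α β : OneForm I M} (hαβ : EngelDefiningForms I D α β) :
    ∃ ω : FormPt I M 2, ∀ x, ∃ u v, u ∈ D x ∧ v ∈ D x ∧ ω.val x ![u, v] ≠ 0 := by
  obtain ⟨hD₂, hD₃, -⟩ := hD
  obtain ⟨hker, hkerα⟩ := hαβ
  set X := α.dualVF F with hX
  set Y := β.dualVF F with hY
  have hXs : SmoothVF I X := α.smoothVF_dualVF hF
  have hYs : SmoothVF I Y := β.smoothVF_dualVF hF
  refine ⟨⟨fun x => ((ν.val x).curryLeft (X x)).curryLeft (Y x), fun V hV => ?_⟩, fun x => ?_⟩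
  · convert ν.smoothFn_four hXs hYs (hV 0) (hV 1) using 2 with x
    change ν.val x _ = _
    congr 1
    funext i
    fin_cases i <;> rfl
  have hcomb : ∀ s t : ℝ, s • X x + t • Y x ∈ D x → s = 0 ∧ t = 0 := by
    intro s t hmem
    rw [hker, Submodule.mem_inf, LinearMap.mem_ker, LinearMap.mem_ker] at hmem
    have hzero : s • α.val x + t • β.val x = 0 := by
      refine linearMap_eq_zero_of_sum_sq (hE x) (hFx x) ?_
      have h : (s • α.val x + t • β.val x) (s • X x + t • Y x) = 0 := by
        simp only [LinearMap.add_apply, LinearMap.smul_apply, hmem.1, hmem.2]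
        simp
      rw [← h]
      simp only [hX, hY, OneForm.dualVF, Finset.smul_sum, ← Finset.sum_add_distrib, map_sum]
      refine Finset.sum_congr rfl fun i _ => ?_
      simp only [map_add, map_smul, LinearMap.add_apply, LinearMap.smul_apply, smul_eq_mul]
      ring
    have ht : t = 0 := by
      by_contra ht
      have hle : LinearMap.ker (α.val x) ≤ LinearMap.ker (β.val x) := by
        intro y hy
        have h := LinearMap.congr_fun hzero y
        simpa [LinearMap.mem_ker.1 hy, ht] using h
      have h₂ := hD₂ x
      rw [hker, inf_eq_left.2 hle, ← hkerα, hD₃ x] at h₂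
      omega
    refine ⟨?_, ht⟩
    by_contra hs
    have hα : α.val x = 0 := by simpa [ht, hs] using hzero
    have hrank := hD₃ x
    rw [hkerα, hα, LinearMap.ker_zero, finrank_top, hE x] at hrank
    omega
  obtain ⟨u, v, hu, hv, huv⟩ := exists_linearIndependent_of_finrank_eq_two (hD₂ x) hcomb
  exact ⟨u, v, hu, hv, alternating_four_ne_zero (hE x) (hν x) huv⟩

variable [I.Boundaryless] [CompleteSpace E]

lemma exists_engelDefiningForms {D : TangentDist I M} (hD : IsEngel I D)
    (hE : ∀ x : M, finrank ℝ (TangentSpace I x) = 4) {F : Fin 4 → VF I M} (hF : ∀ i, SmoothVF I (F i))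
    (hFx : ∀ x, LinearIndependent ℝ (fun i => F i x)) {ν : FormPt I M 4} (hν : ∀ x, ν.val x ≠ 0)
    {ω : FormPt I M 2} (hω : ∀ x, ∃ u v, u ∈ D x ∧ v ∈ D x ∧ ω.val x ![u, v] ≠ 0) :
    ∃ α β : OneForm I M, EngelDefiningForms I D α β := by
  obtain ⟨hD₂, hD₃, -⟩ := hD
  have hcover : ∀ x, ∃ U V, IsSection I D U ∧ IsSection I D V ∧ ω.val x ![U x, V x] ≠ 0 :=
    fun x => exists_isSection_form_ne_zero hD₂ ω (hD₃ x) (hω x)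
  obtain ⟨α, hα⟩ := exists_oneForm_of_sections (D := D) ω ν 2 (vfLie I)
    (fun U V hU hV => hU.1.vfLie hV.1) hcover (by
      intro U V U' V' x hU hV hU' hV' hx hx' y
      have hcomm := alternating_four_mul_comm_of_finrank_eq_two (hD₂ x) (ω.val x) (ν.val x) y
        (vfLie I U V x) (hU.2 x) (hV.2 x) (hU'.2 x) (hV'.2 x)
      have hzero := alternating_four_eq_zero_of_finrank_eq_two (hD₂ x) (ν.val x) y
        (vfLie_sub_mem_of_form hD₂ ω hU hV hU' hV' hx) (hU'.2 x) (hV'.2 x)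
      have hlin : ∀ (a b : ℝ) (A B : TangentSpace I x),
          ν.val x ![y, a • A - b • B, U' x, V' x] =
            a * ν.val x ![y, A, U' x, V' x] - b * ν.val x ![y, B, U' x, V' x] := by
        intro a b A B
        have h := map_sub (alternatingInFirst ((ν.val x).curryLeft y) ![U' x, V' x])
          (a • A) (b • B)
        rw [map_smul, map_smul] at h
        exact h
      rw [hlin] at hzero
      linear_combination (ω.val x ![U x, V x]) * hzero + (ω.val x ![U' x, V' x]) * hcomm)
  have hkerα : ∀ x, derivedDist I D x = LinearMap.ker (α.val x) := by
    intro x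
    obtain ⟨U, V, hU, hV, hx⟩ := hcover x
    rw [hα U V x hU hV hx, derivedDist_eq_span_of_form hD₂ ω hU hV hx]
    exact (ker_alternatingInFirst (hE x) (hν x)
      (linearIndependent_vfLie_of_form hD₂ ω hU hV hx (hD₃ x))).symm
  set N := α.dualVF F with hN
  have hNx : ∀ x, N x ∉ derivedDist I D x := by
    intro x hmem
    rw [hkerα, LinearMap.mem_ker] at hmem
    have hzero : α.val x = 0 := by
      refine linearMap_eq_zero_of_sum_sq (hE x) (hFx x) ?_
      simpa [hN, OneForm.dualVF, sq] using hmem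
    have hrank := hD₃ x
    rw [hkerα, hzero, LinearMap.ker_zero, finrank_top, hE x] at hrank
    omega
  obtain ⟨β, hβ⟩ := exists_oneForm_of_sections (D := D) ω ν 1 (fun _ _ => N)
    (fun U V hU hV => α.smoothVF_dualVF hF) hcover (by
      intro U V U' V' x hU hV hU' hV' hx hx' y
      simpa using alternating_four_mul_comm_of_finrank_eq_two (hD₂ x) (ω.val x) (ν.val x) y (N x)
        (hU.2 x) (hV.2 x) (hU'.2 x) (hV'.2 x))
  refine ⟨α, β, fun x => ?_, hkerα⟩
  obtain ⟨U, V, hU, hV, hx⟩ := hcover x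
  have hUV := linearIndependent_of_alternating_ne_zero hx
  have hspan : Submodule.span ℝ (range ![U x, V x]) = D x := by
    rw [Matrix.range_cons_cons_empty]
    exact span_pair_eq_of_finrank_eq_two (hD₂ x) (hU.2 x) (hV.2 x) hUV
  have hle : D x ≤ derivedDist I D x := by
    rw [← hspan, derivedDist_eq_span_of_form hD₂ ω hU hV hx,
      Matrix.range_cons (vfLie I U V x)]
    exact Submodule.span_mono Set.subset_union_right
  have hNUV : LinearIndependent ℝ ![N x, U x, V x] :=
    linearIndependent_finCons.2 ⟨hUV, fun h => hNx x (hle (hspan ▸ h))⟩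
  rw [← hkerα, hβ U V x hU hV hx]
  have hker := ker_alternatingInFirst (hE x) (hν x) hNUV
  rw [hker, Matrix.range_cons, Set.singleton_union]
  ext y
  rw [Submodule.mem_inf, Submodule.mem_span_insert, hspan]
  constructor
  · exact fun hy => ⟨hle hy, 0, y, hy, by simp⟩
  · rintro ⟨hy, a, z, hz, rfl⟩
    have haN : a • N x ∈ derivedDist I D x := by
      simpa using (derivedDist I D x).sub_mem hy (hle hz)
    by_cases ha : a = 0
    · simpa [ha] using hz
    · exact absurd (((derivedDist I D x).smul_mem_iff ha).1 haN) (hNx x)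

end Frames

/-- Let `M` be a parallelizable orientable smooth 4-manifold and `D` an
Engel structure on `M`.  Then `D` admits Engel defining forms if and only if `D` is
orientable as a plane bundle (i.e. there is a smooth `2`-form restricting to a nowhere
vanishing form on `D`). -/
theorem engel_admits_defining_forms_iff_orientable {M : Type*} [TopologicalSpace M]
    [ChartedSpace (EuclideanSpace ℝ (Fin 4)) M] [IsManifold (𝓡 4) (⊤ : ℕ∞) M]
    (D : TangentDist (𝓡 4) M) (hD : IsEngel (𝓡 4) D)
    -- `M` is parallelizable
    (hpar : ∃ F : Fin 4 → VF (𝓡 4) M, (∀ i, SmoothVF (𝓡 4) (F i)) ∧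
      ∀ x, LinearIndependent ℝ (fun i => F i x))
    -- `M` is orientable
    (hor : ∃ vol : FormPt (𝓡 4) M 4, ∀ x, vol.val x ≠ 0) :
    (∃ α β : OneForm (𝓡 4) M, EngelDefiningForms (𝓡 4) D α β) ↔
      (∃ ω : FormPt (𝓡 4) M 2, ∀ x, ∃ u v,
        u ∈ D x ∧ v ∈ D x ∧ ω.val x ![u, v] ≠ 0) := by
  obtain ⟨F, hF, hFx⟩ := hpar
  obtain ⟨ν, hν⟩ := hor
  have hE : ∀ x : M, finrank ℝ (TangentSpace (𝓡 4) x) = 4 := fun _ => finrank_euclideanSpace_fin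
  constructor
  · rintro ⟨α, β, hαβ⟩
    exact exists_form_of_engelDefiningForms hD hE hF hFx hν hαβ
  · rintro ⟨ω, hω⟩
    exact exists_engelDefiningForms hD hE hF hFx hν hω

end
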